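/- Let (x*, y*) ∈ Z satisfy CC-MFCQ. Then there exists r > 0 such that for every sequence (t_k) of positive reals with t_k → 0 and every sequence of KKT points (x^k, y^k) of NLP(t_k) with ‖x^k − x*‖ < r for all k, the sequence (x^k, y^k) has at least one accumulation point, and every accumulation point (x̄, ȳ) is an S-stationary point of the continuous reformulation. -/

import Mathlib

open Set Filter Topology

noncomputable section

/-- Number of nonzero components of a vector (the "zero norm"). -/
def card0 {n : ℕ} (x : Fin n → ℝ) : ℕ := {i | x i ≠ 0}.ncard

/-- First directional derivative `∇φ(x)ᵀd`. -/
def D1 {n : ℕ} (φ : (Fin n → ℝ) → ℝ) (x d : Fin n → ℝ) : ℝ := fderiv ℝ φ x d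

/-- Second derivative quadratic form `dᵀ∇²φ(x)d`. -/
def D2 {n : ℕ} (φ : (Fin n → ℝ) → ℝ) (x d : Fin n → ℝ) : ℝ :=
  iteratedFDeriv ℝ 2 φ x ![d, d]

/-- Feasibility for the cardinality constrained problem (CCP):
`g(x) ≤ 0`, `h(x) = 0`, `‖x‖₀ ≤ κ`. -/
def CCPFeasible {n m p : ℕ} (g : (Fin n → ℝ) → Fin m → ℝ) (h : (Fin n → ℝ) → Fin p → ℝ)
    (κ : ℕ) (x : Fin n → ℝ) : Prop :=
  (∀ i, g x i ≤ 0) ∧ (∀ i, h x i = 0) ∧ card0 x ≤ κ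

/-- Feasible set `Z` of the continuous reformulation. -/
def ZSet {n m p : ℕ} (g : (Fin n → ℝ) → Fin m → ℝ) (h : (Fin n → ℝ) → Fin p → ℝ)
    (κ : ℕ) : Set ((Fin n → ℝ) × (Fin n → ℝ)) :=
  {z | (∀ i, g z.1 i ≤ 0) ∧ (∀ i, h z.1 i = 0) ∧ (∀ i, 0 ≤ z.2 i) ∧ (∀ i, z.2 i ≤ 1) ∧
    ((n : ℝ) - (κ : ℝ) ≤ ∑ i, z.2 i) ∧ ∀ i, z.1 i * z.2 i = 0}

/-- `(lam, mu, gam)` is an M-stationary multiplier at `x`. -/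
def IsMMult {n m p : ℕ} (f : (Fin n → ℝ) → ℝ) (g : (Fin n → ℝ) → Fin m → ℝ)
    (h : (Fin n → ℝ) → Fin p → ℝ) (x : Fin n → ℝ)
    (lam : Fin m → ℝ) (mu : Fin p → ℝ) (gam : Fin n → ℝ) : Prop :=
  (∀ d, D1 f x d + ∑ i, lam i * D1 (fun x' => g x' i) x d
      + ∑ i, mu i * D1 (fun x' => h x' i) x d + ∑ i, gam i * d i = 0) ∧
  (∀ i, 0 ≤ lam i) ∧ (∀ i, lam i * g x i = 0) ∧ (∀ i, x i ≠ 0 → gam i = 0)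

/-- `(lam, mu, gam)` is an S-stationary multiplier at `(x, y)`. -/
def IsSMult {n m p : ℕ} (f : (Fin n → ℝ) → ℝ) (g : (Fin n → ℝ) → Fin m → ℝ)
    (h : (Fin n → ℝ) → Fin p → ℝ) (x y : Fin n → ℝ)
    (lam : Fin m → ℝ) (mu : Fin p → ℝ) (gam : Fin n → ℝ) : Prop :=
  IsMMult f g h x lam mu gam ∧ ∀ i, x i = 0 → y i = 0 → gam i = 0

/-- `z` is an M-stationary point of the continuous reformulation. -/
def MStationary {n m p : ℕ} (f : (Fin n → ℝ) → ℝ) (g : (Fin n → ℝ) → Fin m → ℝ)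
    (h : (Fin n → ℝ) → Fin p → ℝ) (κ : ℕ) (z : (Fin n → ℝ) × (Fin n → ℝ)) : Prop :=
  z ∈ ZSet g h κ ∧ ∃ lam mu gam, IsMMult f g h z.1 lam mu gam

/-- `z` is an S-stationary point of the continuous reformulation. -/
def SStationary {n m p : ℕ} (f : (Fin n → ℝ) → ℝ) (g : (Fin n → ℝ) → Fin m → ℝ)
    (h : (Fin n → ℝ) → Fin p → ℝ) (κ : ℕ) (z : (Fin n → ℝ) × (Fin n → ℝ)) : Prop :=
  z ∈ ZSet g h κ ∧ ∃ lam mu gam, IsSMult f g h z.1 z.2 lam mu gam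

/-- CC-LICQ at `x`: the active gradients `∇gᵢ(x)` (`gᵢ(x) = 0`), all `∇hᵢ(x)`,
and the unit vectors `eᵢ` (`xᵢ = 0`) are linearly independent. -/
def CCLICQ {n m p : ℕ} (g : (Fin n → ℝ) → Fin m → ℝ) (h : (Fin n → ℝ) → Fin p → ℝ)
    (x : Fin n → ℝ) : Prop :=
  ∀ (lam : Fin m → ℝ) (mu : Fin p → ℝ) (gam : Fin n → ℝ),
    (∀ i, g x i ≠ 0 → lam i = 0) → (∀ i, x i ≠ 0 → gam i = 0) →
    (∀ d, ∑ i, lam i * D1 (fun x' => g x' i) x d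
        + ∑ i, mu i * D1 (fun x' => h x' i) x d + ∑ i, gam i * d i = 0) →
    lam = 0 ∧ mu = 0 ∧ gam = 0

/-- CC-MFCQ at `x`: the active gradients `∇gᵢ(x)` together with all `∇hᵢ(x)` and the
unit vectors `eᵢ` (`xᵢ = 0`) are positively linearly independent. -/
def CCMFCQ {n m p : ℕ} (g : (Fin n → ℝ) → Fin m → ℝ) (h : (Fin n → ℝ) → Fin p → ℝ)
    (x : Fin n → ℝ) : Prop :=
  ∀ (lam : Fin m → ℝ) (mu : Fin p → ℝ) (gam : Fin n → ℝ),
    (∀ i, 0 ≤ lam i) → (∀ i, g x i ≠ 0 → lam i = 0) → (∀ i, x i ≠ 0 → gam i = 0) →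
    (∀ d, ∑ i, lam i * D1 (fun x' => g x' i) x d
        + ∑ i, mu i * D1 (fun x' => h x' i) x d + ∑ i, gam i * d i = 0) →
    lam = 0 ∧ mu = 0 ∧ gam = 0

/-- The linear combination `Σ lamᵢ ∇gᵢ(x) + Σ muᵢ ∇hᵢ(x) + Σ gamᵢ eᵢ` vanishes. -/
def CombZero {n m p : ℕ} (g : (Fin n → ℝ) → Fin m → ℝ) (h : (Fin n → ℝ) → Fin p → ℝ)
    (lam : Fin m → ℝ) (mu : Fin p → ℝ) (gam : Fin n → ℝ) (x : Fin n → ℝ) : Prop :=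
  ∀ d, ∑ i, lam i * D1 (fun x' => g x' i) x d
      + ∑ i, mu i * D1 (fun x' => h x' i) x d + ∑ i, gam i * d i = 0

/-- CC-CPLD at `x`: whenever gradients indexed by subsets of the active sets are
positively linearly dependent at `x`, they remain linearly dependent nearby. -/
def CCCPLD {n m p : ℕ} (g : (Fin n → ℝ) → Fin m → ℝ) (h : (Fin n → ℝ) → Fin p → ℝ)
    (x : Fin n → ℝ) : Prop :=
  ∀ (I1 : Finset (Fin m)) (I2 : Finset (Fin p)) (I3 : Finset (Fin n)),
    (∀ i ∈ I1, g x i = 0) → (∀ i ∈ I3, x i = 0) →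
    (∃ lam mu gam, (∀ i, 0 ≤ lam i) ∧ (∀ i, i ∉ I1 → lam i = 0) ∧ (∀ i, i ∉ I2 → mu i = 0) ∧
      (∀ i, i ∉ I3 → gam i = 0) ∧ ¬(lam = 0 ∧ mu = 0 ∧ gam = 0) ∧ CombZero g h lam mu gam x) →
    ∀ᶠ x' in nhds x, ∃ lam mu gam, (∀ i, i ∉ I1 → lam i = 0) ∧ (∀ i, i ∉ I2 → mu i = 0) ∧
      (∀ i, i ∉ I3 → gam i = 0) ∧ ¬(lam = 0 ∧ mu = 0 ∧ gam = 0) ∧ CombZero g h lam mu gam x'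

/-- The CC-linearisation cone `L_Z(x, y)` (as a predicate on `(dx, dy)`). -/
def LinCone {n m p : ℕ} (g : (Fin n → ℝ) → Fin m → ℝ) (h : (Fin n → ℝ) → Fin p → ℝ)
    (κ : ℕ) (x y dx dy : Fin n → ℝ) : Prop :=
  (∀ i, g x i = 0 → D1 (fun x' => g x' i) x dx ≤ 0) ∧
  (∀ i, D1 (fun x' => h x' i) x dx = 0) ∧
  ((∑ i, y i = (n : ℝ) - (κ : ℝ)) → 0 ≤ ∑ i, dy i) ∧
  (∀ i, x i ≠ 0 → y i = 0 → dy i = 0) ∧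
  (∀ i, x i = 0 → y i = 0 → 0 ≤ dy i) ∧
  (∀ i, x i = 0 → y i = 1 → dy i ≤ 0) ∧
  (∀ i, x i = 0 → 0 < y i → dx i = 0) ∧
  (∀ i, x i = 0 → y i = 0 → dx i * dy i = 0)

/-- The CC-critical cone `C_Z(x, y)`. -/
def CritCone {n m p : ℕ} (f : (Fin n → ℝ) → ℝ) (g : (Fin n → ℝ) → Fin m → ℝ)
    (h : (Fin n → ℝ) → Fin p → ℝ) (κ : ℕ) (x y dx dy : Fin n → ℝ) : Prop :=
  LinCone g h κ x y dx dy ∧ D1 f x dx ≤ 0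

/-- The critical cone `C_X(x)` for the original cardinality constrained problem. -/
def CritConeX {n m p : ℕ} (f : (Fin n → ℝ) → ℝ) (g : (Fin n → ℝ) → Fin m → ℝ)
    (h : (Fin n → ℝ) → Fin p → ℝ) (κ : ℕ) (x dx : Fin n → ℝ) : Prop :=
  (∀ i, g x i = 0 → D1 (fun x' => g x' i) x dx ≤ 0) ∧
  (∀ i, D1 (fun x' => h x' i) x dx = 0) ∧
  (n - κ ≤ {i | x i = 0 ∧ dx i = 0}.ncard) ∧
  D1 f x dx ≤ 0

/-- `x` is a local minimum of the cardinality constrained problem. -/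
def LocalMinCCP {n m p : ℕ} (f : (Fin n → ℝ) → ℝ) (g : (Fin n → ℝ) → Fin m → ℝ)
    (h : (Fin n → ℝ) → Fin p → ℝ) (κ : ℕ) (x : Fin n → ℝ) : Prop :=
  CCPFeasible g h κ x ∧ ∃ r > (0 : ℝ), ∀ x', CCPFeasible g h κ x' → dist x' x < r → f x ≤ f x'

/-- `x` is a strict local minimum of the cardinality constrained problem. -/
def StrictLocalMinCCP {n m p : ℕ} (f : (Fin n → ℝ) → ℝ) (g : (Fin n → ℝ) → Fin m → ℝ)
    (h : (Fin n → ℝ) → Fin p → ℝ) (κ : ℕ) (x : Fin n → ℝ) : Prop :=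
  CCPFeasible g h κ x ∧
    ∃ r > (0 : ℝ), ∀ x', CCPFeasible g h κ x' → dist x' x < r → x' ≠ x → f x < f x'

/-- `z` is a local minimum of the continuous reformulation. -/
def LocalMinZ {n m p : ℕ} (f : (Fin n → ℝ) → ℝ) (g : (Fin n → ℝ) → Fin m → ℝ)
    (h : (Fin n → ℝ) → Fin p → ℝ) (κ : ℕ) (z : (Fin n → ℝ) × (Fin n → ℝ)) : Prop :=
  z ∈ ZSet g h κ ∧ ∃ r > (0 : ℝ), ∀ z' ∈ ZSet g h κ, dist z' z < r → f z.1 ≤ f z'.1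

/-- `z` is a strict local minimum with respect to `x` of the continuous reformulation. -/
def StrictLocalMinX {n m p : ℕ} (f : (Fin n → ℝ) → ℝ) (g : (Fin n → ℝ) → Fin m → ℝ)
    (h : (Fin n → ℝ) → Fin p → ℝ) (κ : ℕ) (z : (Fin n → ℝ) × (Fin n → ℝ)) : Prop :=
  z ∈ ZSet g h κ ∧
    ∃ r > (0 : ℝ), ∀ z' ∈ ZSet g h κ, dist z' z < r → z'.1 ≠ z.1 → f z.1 < f z'.1

/-- Feasible set `Z(t)` of the Scholtes-type regularized program NLP(t). -/
def ZReg {n m p : ℕ} (g : (Fin n → ℝ) → Fin m → ℝ) (h : (Fin n → ℝ) → Fin p → ℝ)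
    (κ : ℕ) (t : ℝ) : Set ((Fin n → ℝ) × (Fin n → ℝ)) :=
  {z | (∀ i, g z.1 i ≤ 0) ∧ (∀ i, h z.1 i = 0) ∧ (∀ i, 0 ≤ z.2 i) ∧ (∀ i, z.2 i ≤ 1) ∧
    ((n : ℝ) - (κ : ℝ) ≤ ∑ i, z.2 i) ∧ (∀ i, z.1 i * z.2 i ≤ t) ∧ ∀ i, -t ≤ z.1 i * z.2 i}

/-- `z` is a local minimum of the regularized program NLP(t). -/
def LocalMinReg {n m p : ℕ} (f : (Fin n → ℝ) → ℝ) (g : (Fin n → ℝ) → Fin m → ℝ)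
    (h : (Fin n → ℝ) → Fin p → ℝ) (κ : ℕ) (t : ℝ) (z : (Fin n → ℝ) × (Fin n → ℝ)) : Prop :=
  z ∈ ZReg g h κ t ∧ ∃ r > (0 : ℝ), ∀ z' ∈ ZReg g h κ t, dist z' z < r → f z.1 ≤ f z'.1

/-- `z` is a KKT point of the regularized program NLP(t). -/
def KKTReg {n m p : ℕ} (f : (Fin n → ℝ) → ℝ) (g : (Fin n → ℝ) → Fin m → ℝ)
    (h : (Fin n → ℝ) → Fin p → ℝ) (κ : ℕ) (t : ℝ) (z : (Fin n → ℝ) × (Fin n → ℝ)) : Prop :=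
  z ∈ ZReg g h κ t ∧
  ∃ (lam : Fin m → ℝ) (mu : Fin p → ℝ) (nu0 nu1 : Fin n → ℝ) (rho : ℝ) (dpl dmi : Fin n → ℝ),
    (∀ d : Fin n → ℝ, D1 f z.1 d + ∑ i, lam i * D1 (fun x' => g x' i) z.1 d
        + ∑ i, mu i * D1 (fun x' => h x' i) z.1 d
        + ∑ i, (dpl i - dmi i) * z.2 i * d i = 0) ∧
    (∀ i, -nu0 i + nu1 i - rho + (dpl i - dmi i) * z.1 i = 0) ∧
    (∀ i, 0 ≤ lam i) ∧ (∀ i, 0 ≤ nu0 i) ∧ (∀ i, 0 ≤ nu1 i) ∧ 0 ≤ rho ∧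
    (∀ i, 0 ≤ dpl i) ∧ (∀ i, 0 ≤ dmi i) ∧
    (∀ i, lam i * g z.1 i = 0) ∧ (∀ i, nu0 i * z.2 i = 0) ∧ (∀ i, nu1 i * (z.2 i - 1) = 0) ∧
    rho * (∑ i, z.2 i - ((n : ℝ) - (κ : ℝ))) = 0 ∧
    (∀ i, dpl i * (z.1 i * z.2 i - t) = 0) ∧ (∀ i, dmi i * (z.1 i * z.2 i + t) = 0)

/-- Standard MFCQ for the regularized program NLP(t) at a feasible point `z`. -/
def MFCQReg {n m p : ℕ} (g : (Fin n → ℝ) → Fin m → ℝ) (h : (Fin n → ℝ) → Fin p → ℝ)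
    (κ : ℕ) (t : ℝ) (z : (Fin n → ℝ) × (Fin n → ℝ)) : Prop :=
  (∀ mu : Fin p → ℝ, (∀ d, ∑ i, mu i * D1 (fun x' => h x' i) z.1 d = 0) → mu = 0) ∧
  ∃ dx dy : Fin n → ℝ,
    (∀ i, D1 (fun x' => h x' i) z.1 dx = 0) ∧
    (∀ i, g z.1 i = 0 → D1 (fun x' => g x' i) z.1 dx < 0) ∧
    (∀ i, z.2 i = 0 → 0 < dy i) ∧
    (∀ i, z.2 i = 1 → dy i < 0) ∧
    (∑ i, z.2 i = (n : ℝ) - (κ : ℝ) → 0 < ∑ i, dy i) ∧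
    (∀ i, z.1 i * z.2 i = t → z.2 i * dx i + z.1 i * dy i < 0) ∧
    (∀ i, z.1 i * z.2 i = -t → 0 < z.2 i * dx i + z.1 i * dy i)

/-- Numbers in `[0, 1]` with integer sum, one of which is strictly between `0` and `1`, contain
one that is smaller than `1` and at least `1 / n`. -/
lemma exists_lt_one_of_sum_eq_int {n : ℕ} {y : Fin n → ℝ} (hy0 : ∀ i, 0 ≤ y i)
    {N : ℤ} (hsum : ∑ i, y i = N) {i : Fin n} (hi0 : 0 < y i) (hi1 : y i < 1)
    (hy1 : ∀ i, y i ≤ 1) : ∃ l, y l < 1 ∧ 1 ≤ n * y l := by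
  by_contra! hcon
  have hn : (0 : ℝ) < n := by exact_mod_cast i.pos
  set S := Finset.univ.filter fun l => y l < 1
  have hiS : i ∈ S := by simp [S, hi1]
  have hsplit := Finset.sum_filter_add_sum_filter_not Finset.univ (fun l => y l < 1) y
  have hones : ∑ l ∈ Finset.univ.filter (fun l => ¬ y l < 1), y l =
      ((Finset.univ.filter fun l => ¬ y l < 1).card : ℝ) := by
    rw [Finset.sum_congr rfl (g := fun _ => (1 : ℝ)), Finset.sum_const, nsmul_eq_mul, mul_one]
    intro l hl
    exact le_antisymm (hy1 l) (not_lt.1 (Finset.mem_filter.1 hl).2)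
  have hpos : 0 < ∑ l ∈ S, y l := Finset.sum_pos' (fun l _ => hy0 l) ⟨i, hiS, hi0⟩
  have hint : ∑ l ∈ S, y l =
      ((N - ((Finset.univ.filter fun l => ¬ y l < 1).card : ℤ) : ℤ) : ℝ) := by
    push_cast
    rw [← hones, ← hsum, ← hsplit]
    ring
  have hone : 1 ≤ ∑ l ∈ S, y l := by
    rw [hint] at hpos ⊢
    exact_mod_cast hpos
  have hlt : ∑ l ∈ S, n * y l < ∑ _l ∈ S, (1 : ℝ) :=
    Finset.sum_lt_sum_of_nonempty ⟨i, hiS⟩ fun l hl => hcon l (Finset.mem_filter.1 hl).2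
  have hcard : (S.card : ℝ) ≤ n := by exact_mod_cast card_finset_fin_le S
  rw [← Finset.mul_sum, Finset.sum_const, nsmul_eq_mul, mul_one] at hlt
  nlinarith

/-- Multipliers of the `i`-th pair of relaxed complementarity constraints. -/
lemma abs_mul_eq_of_complementarity {a b x y t : ℝ} (ht : 0 < t) (hy : 0 ≤ y) (ha : 0 ≤ a)
    (hb : 0 ≤ b) (hat : a * (x * y - t) = 0) (hbt : b * (x * y + t) = 0) :
    |(a - b) * y| * t = y ^ 2 * ((a - b) * x) := by
  rcases mul_eq_zero.1 hat with rfl | hxy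
  · rw [zero_sub, neg_mul, abs_neg, abs_of_nonneg (mul_nonneg hb hy)]
    linear_combination y * hbt
  · have hb0 : b = 0 := (mul_eq_zero.1 hbt).resolve_right (by linarith)
    subst hb0
    rw [sub_zero, abs_of_nonneg (mul_nonneg ha hy)]
    linear_combination (-y) * hat

/-- At a KKT point of the regularized program, the multiplier `gam` of the coordinate vectors is
controlled by `y`. -/
lemma abs_mul_le_of_regularized_dual {n κ : ℕ} {t : ℝ} (ht : 0 < t)
    {x y nu0 nu1 dpl dmi : Fin n → ℝ} {rho : ℝ} (hy0 : ∀ i, 0 ≤ y i) (hy1 : ∀ i, y i ≤ 1)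
    (hst : ∀ i, -nu0 i + nu1 i - rho + (dpl i - dmi i) * x i = 0)
    (hnu1 : ∀ i, 0 ≤ nu1 i) (hrho : 0 ≤ rho) (hpl : ∀ i, 0 ≤ dpl i) (hmi : ∀ i, 0 ≤ dmi i)
    (h0 : ∀ i, nu0 i * y i = 0) (h1 : ∀ i, nu1 i * (y i - 1) = 0)
    (hr : rho * (∑ i, y i - ((n : ℝ) - (κ : ℝ))) = 0)
    (hplt : ∀ i, dpl i * (x i * y i - t) = 0) (hmit : ∀ i, dmi i * (x i * y i + t) = 0)
    (i : Fin n) :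
    |(dpl i - dmi i) * y i| ≤ n ^ 2 * y i ^ 2 * ‖fun l => (dpl l - dmi l) * y l‖ := by
  have key l := abs_mul_eq_of_complementarity ht (hy0 l) (hpl l) (hmi l) (hplt l) (hmit l)
  have hle l : |(dpl l - dmi l) * y l| ≤ ‖fun l => (dpl l - dmi l) * y l‖ :=
    norm_le_pi_norm (fun l => (dpl l - dmi l) * y l) l
  have hn : (1 : ℝ) ≤ n := by exact_mod_cast i.pos
  rcases (hy0 i).eq_or_lt with hi0 | hi0
  · simp [← hi0]
  rcases (hy1 i).eq_or_lt with hi1 | hi1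
  · have hsq : (n : ℝ) ^ 2 * y i ^ 2 = n ^ 2 := by rw [hi1, one_pow, mul_one]
    rw [hsq]
    exact (hle i).trans (le_mul_of_one_le_left (norm_nonneg _) (one_le_pow₀ hn))
  have hnu0 : nu0 i = 0 := (mul_eq_zero.1 (h0 i)).resolve_right hi0.ne'
  have hki : |(dpl i - dmi i) * y i| * t ≤ y i ^ 2 * rho := by
    rw [key i]
    exact mul_le_mul_of_nonneg_left (by linarith [hst i, hnu1 i]) (sq_nonneg _)
  rcases hrho.eq_or_lt with rfl | hrho
  · have : |(dpl i - dmi i) * y i| ≤ 0 := by nlinarith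
    exact this.trans (by positivity)
  have hsum : ∑ i, y i = (((n : ℤ) - (κ : ℤ) : ℤ) : ℝ) := by
    push_cast
    linarith [(mul_eq_zero.1 hr).resolve_left hrho.ne']
  obtain ⟨l, hl1, hl⟩ := exists_lt_one_of_sum_eq_int hy0 hsum hi0 hi1 hy1
  have hl0 : 0 < y l := by
    by_contra! hcon
    nlinarith
  have hnu0l : nu0 l = 0 := (mul_eq_zero.1 (h0 l)).resolve_right hl0.ne'
  have hnu1l : nu1 l = 0 := (mul_eq_zero.1 (h1 l)).resolve_right (by linarith)
  have hkl : |(dpl l - dmi l) * y l| * t = y l ^ 2 * rho := by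
    rw [key l]
    congr 1
    linarith [hst l]
  refine le_of_mul_le_mul_right ?_ ht
  have hsq : (1 : ℝ) ≤ n ^ 2 * y l ^ 2 := by nlinarith
  calc |(dpl i - dmi i) * y i| * t ≤ y i ^ 2 * rho := hki
    _ ≤ y i ^ 2 * rho * (n ^ 2 * y l ^ 2) := le_mul_of_one_le_right (by positivity) hsq
    _ = n ^ 2 * y i ^ 2 * (|(dpl l - dmi l) * y l| * t) := by rw [hkl]; ring
    _ ≤ n ^ 2 * y i ^ 2 * (‖fun l => (dpl l - dmi l) * y l‖ * t) := by
        gcongr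
        exact hle l
    _ = _ := by ring

/-- `w = (α, lam, mu, gam)` is a Fritz John multiplier at `x`, where `α` is the weight of the
objective and no restriction on the support of `gam` is imposed. -/
def IsFJMult {n m p : ℕ} (f : (Fin n → ℝ) → ℝ) (g : (Fin n → ℝ) → Fin m → ℝ)
    (h : (Fin n → ℝ) → Fin p → ℝ) (x : Fin n → ℝ)
    (w : ℝ × (Fin m → ℝ) × (Fin p → ℝ) × (Fin n → ℝ)) : Prop :=
  (∀ d, w.1 * D1 f x d + ∑ i, w.2.1 i * D1 (fun x' => g x' i) x d
      + ∑ i, w.2.2.1 i * D1 (fun x' => h x' i) x d + ∑ i, w.2.2.2 i * d i = 0) ∧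
  0 ≤ w.1 ∧ (∀ i, 0 ≤ w.2.1 i) ∧ (∀ i, w.2.1 i * g x i = 0)

lemma IsFJMult.smul {n m p : ℕ} {f : (Fin n → ℝ) → ℝ} {g : (Fin n → ℝ) → Fin m → ℝ}
    {h : (Fin n → ℝ) → Fin p → ℝ} {x : Fin n → ℝ}
    {w : ℝ × (Fin m → ℝ) × (Fin p → ℝ) × (Fin n → ℝ)} (hw : IsFJMult f g h x w)
    {c : ℝ} (hc : 0 ≤ c) : IsFJMult f g h x (c • w) := by
  obtain ⟨h1, h2, h3, h4⟩ := hw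
  refine ⟨fun d => ?_, mul_nonneg hc h2, fun i => mul_nonneg hc (h3 i), fun i => ?_⟩
  · have := congrArg (c * ·) (h1 d)
    simpa [mul_add, Finset.mul_sum, mul_assoc] using this
  · simp [mul_assoc, h4 i]

lemma continuous_D1 {n : ℕ} {φ : (Fin n → ℝ) → ℝ} (hφ : ContDiff ℝ 1 φ) (d : Fin n → ℝ) :
    Continuous fun x => D1 φ x d :=
  (hφ.continuous_fderiv one_ne_zero).clm_apply continuous_const

lemma isClosed_setOf_isFJMult {n m p : ℕ} {f : (Fin n → ℝ) → ℝ} {g : (Fin n → ℝ) → Fin m → ℝ}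
    {h : (Fin n → ℝ) → Fin p → ℝ} (hf : ContDiff ℝ 1 f)
    (hg : ∀ i, ContDiff ℝ 1 (fun x => g x i)) (hh : ∀ i, ContDiff ℝ 1 (fun x => h x i)) :
    IsClosed {q : (Fin n → ℝ) × (ℝ × (Fin m → ℝ) × (Fin p → ℝ) × (Fin n → ℝ)) |
      IsFJMult f g h q.1 q.2} := by
  have hDf d := (continuous_D1 hf d).comp
    (continuous_fst (X := Fin n → ℝ) (Y := ℝ × (Fin m → ℝ) × (Fin p → ℝ) × (Fin n → ℝ)))
  have hDg i d := (continuous_D1 (hg i) d).comp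
    (continuous_fst (X := Fin n → ℝ) (Y := ℝ × (Fin m → ℝ) × (Fin p → ℝ) × (Fin n → ℝ)))
  have hDh i d := (continuous_D1 (hh i) d).comp
    (continuous_fst (X := Fin n → ℝ) (Y := ℝ × (Fin m → ℝ) × (Fin p → ℝ) × (Fin n → ℝ)))
  have hgc i := (hg i).continuous.comp
    (continuous_fst (X := Fin n → ℝ) (Y := ℝ × (Fin m → ℝ) × (Fin p → ℝ) × (Fin n → ℝ)))
  simp only [Function.comp_def] at hDf hDg hDh hgc
  simp only [IsFJMult, ofPred_and, ofPred_forall]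
  refine (isClosed_iInter fun d => isClosed_eq ?_ continuous_const).inter
    ((isClosed_le continuous_const (by fun_prop)).inter
    ((isClosed_iInter fun i => isClosed_le continuous_const (by fun_prop)).inter
    (isClosed_iInter fun i => isClosed_eq ?_ continuous_const)))
  · refine (((Continuous.mul (by fun_prop) (hDf d)).add ?_).add ?_).add (by fun_prop)
    · exact continuous_finsetSum _ fun i _ => Continuous.mul (by fun_prop) (hDg i d)
    · exact continuous_finsetSum _ fun i _ => Continuous.mul (by fun_prop) (hDh i d)
  · exact Continuous.mul (by fun_prop) (hgc i)

/-- Under CC-MFCQ there is no nontrivial abnormal Fritz John multiplier. -/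
lemma CCMFCQ.eq_zero {n m p : ℕ} {f : (Fin n → ℝ) → ℝ} {g : (Fin n → ℝ) → Fin m → ℝ}
    {h : (Fin n → ℝ) → Fin p → ℝ} {x : Fin n → ℝ} (hx : CCMFCQ g h x)
    {w : ℝ × (Fin m → ℝ) × (Fin p → ℝ) × (Fin n → ℝ)} (hw : IsFJMult f g h x w)
    (hw1 : w.1 = 0) (hgam : ∀ i, w.2.2.2 i * x i = 0) : w = 0 := by
  obtain ⟨h1, -, h3, h4⟩ := hw
  obtain ⟨ha, hb, hc⟩ := hx w.2.1 w.2.2.1 w.2.2.2 h3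
    (fun i hi => (mul_eq_zero.1 (h4 i)).resolve_right hi)
    (fun i hi => (mul_eq_zero.1 (hgam i)).resolve_right hi)
    (fun d => by simpa [hw1] using h1 d)
  exact Prod.ext hw1 (Prod.ext ha (Prod.ext hb hc))

/-- CC-MFCQ is stable under small perturbations of the point. -/
lemma CCMFCQ.eventually {n m p : ℕ} {g : (Fin n → ℝ) → Fin m → ℝ}
    {h : (Fin n → ℝ) → Fin p → ℝ} (hg : ∀ i, ContDiff ℝ 1 (fun x => g x i))
    (hh : ∀ i, ContDiff ℝ 1 (fun x => h x i)) {xs : Fin n → ℝ} (hxs : CCMFCQ g h xs) :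
    ∀ᶠ x in 𝓝 xs, CCMFCQ g h x := by
  have hclosed : IsClosed {q : (Fin n → ℝ) × (ℝ × (Fin m → ℝ) × (Fin p → ℝ) × (Fin n → ℝ)) |
      IsFJMult 0 g h q.1 q.2 ∧ q.2.1 = 0 ∧ ∀ i, q.2.2.2.2 i * q.1 i = 0} := by
    simp only [ofPred_and, ofPred_forall]
    exact (isClosed_setOf_isFJMult contDiff_const hg hh).inter
      ((isClosed_eq (by fun_prop) continuous_const).inter
      (isClosed_iInter fun i => isClosed_eq (by fun_prop) continuous_const))
  have hev : ∀ᶠ x in 𝓝 xs,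
      ∀ w ∈ Metric.sphere (0 : ℝ × (Fin m → ℝ) × (Fin p → ℝ) × (Fin n → ℝ)) 1,
        ¬(IsFJMult 0 g h x w ∧ w.1 = 0 ∧ ∀ i, w.2.2.2 i * x i = 0) := by
    refine (isCompact_sphere _ _).eventually_forall_of_forall_eventually fun w hw => ?_
    refine hclosed.isOpen_compl.mem_nhds fun hcon => ?_
    obtain rfl : w = 0 := hxs.eq_zero hcon.1 hcon.2.1 hcon.2.2
    simp at hw
  filter_upwards [hev] with x hx lam mu gam h1 h2 h3 h4
  set w : ℝ × (Fin m → ℝ) × (Fin p → ℝ) × (Fin n → ℝ) := (0, lam, mu, gam) with hw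
  have hFJ : IsFJMult 0 g h x w := by
    refine ⟨fun d => by simpa [hw] using h4 d, le_rfl, h1, fun i => ?_⟩
    by_cases hi : g x i = 0
    · simp [hi]
    · simp [hw, h2 i hi]
  have hw0 : w = 0 := by
    by_contra hne
    refine hx (‖w‖⁻¹ • w) ?_ ⟨hFJ.smul (by positivity), by simp [hw], fun i => ?_⟩
    · simp [norm_smul, norm_ne_zero_iff.2 hne]
    · by_cases hi : x i = 0
      · simp [hi]
      · simp [hw, h3 i hi]
  simpa [hw] using hw0

/-- A KKT point of the regularized program has a normalized Fritz John multiplier whose last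
component is controlled by `y`. -/
lemma KKTReg.exists_isFJMult {n m p : ℕ} {f : (Fin n → ℝ) → ℝ} {g : (Fin n → ℝ) → Fin m → ℝ}
    {h : (Fin n → ℝ) → Fin p → ℝ} {κ : ℕ} {t : ℝ} (ht : 0 < t)
    {z : (Fin n → ℝ) × (Fin n → ℝ)} (hz : KKTReg f g h κ t z) :
    ∃ w ∈ Metric.sphere (0 : ℝ × (Fin m → ℝ) × (Fin p → ℝ) × (Fin n → ℝ)) 1,
      IsFJMult f g h z.1 w ∧ ∀ i, |w.2.2.2 i| ≤ n ^ 2 * z.2 i ^ 2 * ‖w.2.2.2‖ := by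
  obtain ⟨⟨-, -, hy0, hy1, -⟩, lam, mu, nu0, nu1, rho, dpl, dmi, hst, hdual, hlam, -, hnu1, hrho,
    hpl, hmi, hlamg, h0, h1, hr, hplt, hmit⟩ := hz
  set w : ℝ × (Fin m → ℝ) × (Fin p → ℝ) × (Fin n → ℝ) :=
    (1, lam, mu, fun i => (dpl i - dmi i) * z.2 i) with hw
  have hne : w ≠ 0 := fun hcon => one_ne_zero (congrArg Prod.fst hcon)
  have hFJ : IsFJMult f g h z.1 w :=
    ⟨fun d => by simpa [hw] using hst d, zero_le_one, hlam, hlamg⟩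
  refine ⟨‖w‖⁻¹ • w, by simp [norm_smul, norm_ne_zero_iff.2 hne], hFJ.smul (by positivity),
    fun i => ?_⟩
  have := abs_mul_le_of_regularized_dual ht hy0 hy1 hdual hnu1 hrho hpl hmi h0 h1 hr hplt hmit i
  have hmul := mul_le_mul_of_nonneg_left this (inv_nonneg.2 (norm_nonneg w))
  rw [Prod.smul_snd, Prod.smul_snd, Prod.smul_snd, Pi.smul_apply, smul_eq_mul, abs_mul, norm_smul,
    Real.norm_eq_abs, abs_of_nonneg (inv_nonneg.2 (norm_nonneg w)), mul_left_comm]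
  exact hmul

/-- Limits of feasible points of the regularized programs are feasible. -/
lemma mem_ZSet_of_tendsto {n m p : ℕ} {g : (Fin n → ℝ) → Fin m → ℝ}
    {h : (Fin n → ℝ) → Fin p → ℝ} {κ : ℕ} (hg : ∀ i, Continuous (fun x => g x i))
    (hh : ∀ i, Continuous (fun x => h x i)) {t : ℕ → ℝ} (ht : Tendsto t atTop (𝓝 0))
    {z : ℕ → (Fin n → ℝ) × (Fin n → ℝ)} (hz : ∀ k, z k ∈ ZReg g h κ (t k))
    {zbar : (Fin n → ℝ) × (Fin n → ℝ)} (hlim : Tendsto z atTop (𝓝 zbar)) :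
    zbar ∈ ZSet g h κ := by
  have hx : Tendsto (fun k => (z k).1) atTop (𝓝 zbar.1) := (continuous_fst.tendsto _).comp hlim
  have hy : Tendsto (fun k => (z k).2) atTop (𝓝 zbar.2) := (continuous_snd.tendsto _).comp hlim
  have hxi := tendsto_pi_nhds.1 hx
  have hyi := tendsto_pi_nhds.1 hy
  refine ⟨fun i => ?_, fun i => ?_, fun i => ?_, fun i => ?_, ?_, fun i => ?_⟩
  · exact le_of_tendsto' (((hg i).tendsto _).comp hx) fun k => (hz k).1 i
  · exact tendsto_nhds_unique (((hh i).tendsto _).comp hx)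
      (tendsto_const_nhds.congr fun k => ((hz k).2.1 i).symm)
  · exact ge_of_tendsto' (hyi i) fun k => (hz k).2.2.1 i
  · exact le_of_tendsto' (hyi i) fun k => (hz k).2.2.2.1 i
  · exact ge_of_tendsto' (tendsto_finsetSum _ fun i _ => hyi i) fun k => (hz k).2.2.2.2.1
  · refine tendsto_nhds_unique ((hxi i).mul (hyi i)) ?_
    exact tendsto_of_tendsto_of_tendsto_of_le_of_le (by simpa using ht.neg) ht
      (fun k => (hz k).2.2.2.2.2.2 i) (fun k => (hz k).2.2.2.2.2.1 i)

/-- Under CC-MFCQ, limits of KKT points of the regularized programs are S-stationary. -/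
lemma sStationary_of_tendsto {n m p : ℕ} {f : (Fin n → ℝ) → ℝ} {g : (Fin n → ℝ) → Fin m → ℝ}
    {h : (Fin n → ℝ) → Fin p → ℝ} {κ : ℕ} (hf : ContDiff ℝ 1 f)
    (hg : ∀ i, ContDiff ℝ 1 (fun x => g x i)) (hh : ∀ i, ContDiff ℝ 1 (fun x => h x i))
    {t : ℕ → ℝ} (htpos : ∀ k, 0 < t k) (ht : Tendsto t atTop (𝓝 0))
    {z : ℕ → (Fin n → ℝ) × (Fin n → ℝ)} (hz : ∀ k, KKTReg f g h κ (t k) (z k))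
    {zbar : (Fin n → ℝ) × (Fin n → ℝ)} (hlim : Tendsto z atTop (𝓝 zbar))
    (hmfcq : CCMFCQ g h zbar.1) : SStationary f g h κ zbar := by
  have hZ : zbar ∈ ZSet g h κ := mem_ZSet_of_tendsto (fun i => (hg i).continuous)
    (fun i => (hh i).continuous) ht (fun k => (hz k).1) hlim
  choose w hws hw hwy using fun k => (hz k).exists_isFJMult (htpos k)
  obtain ⟨wbar, hwbar, ψ, hψ, hψlim⟩ := (isCompact_sphere _ _).tendsto_subseq hws
  have hzψ : Tendsto (fun k => z (ψ k)) atTop (𝓝 zbar) := hlim.comp hψ.tendsto_atTop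
  have hq := hzψ.prodMk_nhds hψlim
  have hFJ : IsFJMult f g h zbar.1 wbar := by
    have hx : Tendsto (fun k => (z (ψ k)).1) atTop (𝓝 zbar.1) :=
      (continuous_fst.tendsto _).comp hzψ
    exact (isClosed_setOf_isFJMult hf hg hh).mem_of_tendsto (hx.prodMk_nhds hψlim)
      (Eventually.of_forall fun k => hw (ψ k))
  have hgam i : |wbar.2.2.2 i| ≤ n ^ 2 * zbar.2 i ^ 2 * ‖wbar.2.2.2‖ := by
    have hcl : IsClosed {q : ((Fin n → ℝ) × (Fin n → ℝ)) ×
        (ℝ × (Fin m → ℝ) × (Fin p → ℝ) × (Fin n → ℝ)) |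
        |q.2.2.2.2 i| ≤ n ^ 2 * q.1.2 i ^ 2 * ‖q.2.2.2.2‖} :=
      isClosed_le (by fun_prop) (by fun_prop)
    exact hcl.mem_of_tendsto hq (Eventually.of_forall fun k => hwy (ψ k) i)
  have hgam0 i (hi : zbar.2 i = 0) : wbar.2.2.2 i = 0 := by
    simpa [hi] using hgam i
  have hgamx i (hi : zbar.1 i ≠ 0) : wbar.2.2.2 i = 0 :=
    hgam0 i ((mul_eq_zero.1 (hZ.2.2.2.2.2 i)).resolve_left hi)
  have hpos : wbar.1 ≠ 0 := fun hcon => by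
    have := hmfcq.eq_zero hFJ hcon fun i => by
      by_cases hi : zbar.1 i = 0
      · simp [hi]
      · simp [hgamx i hi]
    simp [this] at hwbar
  obtain ⟨h1, -, h3, h4⟩ := hFJ.smul (inv_nonneg.2 hFJ.2.1)
  refine ⟨hZ, _, (wbar.1⁻¹ • wbar).2.2.1, (wbar.1⁻¹ • wbar).2.2.2,
    ⟨fun d => ?_, h3, h4, fun i hi => ?_⟩, fun i _ hi => ?_⟩
  · have := h1 d
    rwa [Prod.smul_fst, smul_eq_mul, inv_mul_cancel₀ hpos, one_mul] at this
  · simp [hgamx i hi]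
  · simp [hgam0 i hi]

theorem stmt14
    {n m p : ℕ} (f : (Fin n → ℝ) → ℝ) (g : (Fin n → ℝ) → Fin m → ℝ)
    (h : (Fin n → ℝ) → Fin p → ℝ) (κ : ℕ)
    (hn : 0 < n) (hm : 0 < m) (hp : 0 < p) (hκ0 : 0 < κ) (hκn : κ < n)
    (hf : ContDiff ℝ 1 f) (hg : ∀ i, ContDiff ℝ 1 (fun x => g x i))
    (hh : ∀ i, ContDiff ℝ 1 (fun x => h x i))
    (xs ys : Fin n → ℝ) (hZ : (xs, ys) ∈ ZSet g h κ) (hmfcq : CCMFCQ g h xs) :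
    ∃ r > (0 : ℝ), ∀ t : ℕ → ℝ, (∀ k, 0 < t k) → Tendsto t atTop (nhds 0) →
      ∀ z : ℕ → (Fin n → ℝ) × (Fin n → ℝ),
        (∀ k, KKTReg f g h κ (t k) (z k)) → (∀ k, dist (z k).1 xs < r) →
        (∃ (zbar : (Fin n → ℝ) × (Fin n → ℝ)) (φ : ℕ → ℕ),
          StrictMono φ ∧ Tendsto (z ∘ φ) atTop (nhds zbar)) ∧
        ∀ zbar : (Fin n → ℝ) × (Fin n → ℝ),
          (∃ φ : ℕ → ℕ, StrictMono φ ∧ Tendsto (z ∘ φ) atTop (nhds zbar)) →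
          SStationary f g h κ zbar := by
  obtain ⟨ε, hε, hball⟩ := Metric.eventually_nhds_iff.1 (hmfcq.eventually hg hh)
  refine ⟨ε / 2, half_pos hε, fun t htpos ht z hz hdist => ⟨?_, ?_⟩⟩
  · have hmem k : z k ∈ Metric.closedBall xs (ε / 2) ×ˢ Icc (0 : Fin n → ℝ) 1 :=
      ⟨(hdist k).le, (hz k).1.2.2.1, (hz k).1.2.2.2.1⟩
    obtain ⟨zbar, -, φ, hφ, hlim⟩ :=
      ((isCompact_closedBall xs (ε / 2)).prod isCompact_Icc).tendsto_subseq hmem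
    exact ⟨zbar, φ, hφ, hlim⟩
  · rintro zbar ⟨φ, hφ, hlim⟩
    have hle : dist zbar.1 xs ≤ ε / 2 :=
      le_of_tendsto' (((continuous_fst.tendsto _).comp hlim).dist tendsto_const_nhds)
        fun k => (hdist (φ k)).le
    exact sStationary_of_tendsto hf hg hh (fun k => htpos (φ k)) (ht.comp hφ.tendsto_atTop)
      (fun k => hz (φ k)) hlim (hball (by linarith))
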